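/- Let d ≥ k > 0 be integers. There exists a constant c > 0 depending only on d and k such that: for every finite field F, every n, every real β with 0 ≤ β ≤ 1, and every collection L of k-planes in F^n with |L| ≥ |F|^{(k+1)(d-k)+β}, one has |⋃_{L' ∈ L} L'| ≥ c · |F|^{d+β}. -/

import Mathlib

open scoped Pointwise

/-- `A` is a `k`-plane (i.e. a `k`-dimensional affine subspace) of the `F`-vector space `V`. -/
def IsPlane (F : Type*) [Field F] {V : Type*} [AddCommGroup V] [Module F V]
    (k : ℕ) (A : Set V) : Prop :=
  ∃ (x : V) (W : Submodule F V), Module.finrank F W = k ∧ A = x +ᵥ (W : Set V)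

namespace MvPolynomial

theorem exists_eq_pow_of_forall_pderiv_eq_zero {σ K : Type*} [Field K] (p : ℕ) [Fact p.Prime]
    [CharP K p] [PerfectRing K p] {f : MvPolynomial σ K} (hf : ∀ i, pderiv i f = 0) :
    ∃ g : MvPolynomial σ K, f = g ^ p := by
  have hdvd : ∀ m ∈ f.support, ∀ i, p ∣ m i := by
    intro m hm i
    rcases Nat.eq_zero_or_pos (m i) with h0 | hpos
    · simp [h0]
    have hle : Finsupp.single i 1 ≤ m := Finsupp.single_le_iff.mpr hpos
    have h := coeff_pderiv (i := i) f (m - Finsupp.single i 1)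
    rw [hf i, tsub_add_cancel_of_le hle, coeff_zero] at h
    have hc := (mul_eq_zero.mp h.symm).resolve_left (mem_support_iff.mp hm)
    rw [← CharP.cast_eq_zero_iff K p]
    have : m i = (m - Finsupp.single i 1 : σ →₀ ℕ) i + 1 := by simp; omega
    rw [this]
    exact_mod_cast hc
  have hrange : f ∈ (expand (σ := σ) (R := K) p).range := by
    rw [f.as_sum]
    refine Subalgebra.sum_mem _ fun m hm => ?_
    let m' : σ →₀ ℕ := m.mapRange (· / p) (by simp)
    refine ⟨monomial m' (coeff m f), ?_⟩
    change expand p (monomial m' (coeff m f)) = _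
    rw [expand_monomial]
    congr 2
    ext i
    simp [m', Nat.mul_div_cancel' (hdvd m hm i)]
  obtain ⟨h, rfl⟩ := hrange
  refine ⟨map (frobeniusEquiv K p).symm.toRingHom h, ?_⟩
  rw [← map_frobenius_expand, map_expand, map_map]
  have : (frobenius K p).comp (frobeniusEquiv K p).symm.toRingHom = RingHom.id K := by
    ext x
    simp
  rw [this, map_id]
  rfl

theorem totalDegree_pderiv_lt {σ R : Type*} [CommSemiring R] {f : MvPolynomial σ R} {i : σ}
    (h : pderiv i f ≠ 0) : (pderiv i f).totalDegree < f.totalDegree := by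
  obtain ⟨m, hm, hdeg⟩ := Finset.exists_mem_eq_sup _ (support_nonempty.mpr h)
    (fun m => m.sum fun _ e => e)
  rw [totalDegree, hdeg]
  have hm' : m + Finsupp.single i 1 ∈ f.support := by
    rw [mem_support_iff, coeff_pderiv] at *
    exact left_ne_zero_of_mul hm
  have := le_totalDegree hm'
  rw [Finsupp.sum_add_index' (by simp) (by simp), Finsupp.sum_single_index rfl] at this
  exact this

theorem exists_eval_pderiv_ne_zero {σ K : Type*} [Field K] (p : ℕ) [Fact p.Prime]
    [CharP K p] [PerfectRing K p] {J : Set (σ → K)} (hJ : J.Nonempty) {f : MvPolynomial σ K}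
    (hf0 : f ≠ 0) (hf : ∀ x ∈ J, eval x f = 0)
    (hmin : ∀ g : MvPolynomial σ K, g ≠ 0 → (∀ x ∈ J, eval x g = 0) →
      f.totalDegree ≤ g.totalDegree) :
    ∃ x ∈ J, ∃ i, eval x (pderiv i f) ≠ 0 := by
  by_contra! hcon
  have hzero : ∀ i, pderiv i f = 0 := fun i => by
    by_contra h
    exact (totalDegree_pderiv_lt h).not_ge (hmin _ h fun x hx => hcon x hx i)
  obtain ⟨g, rfl⟩ := exists_eq_pow_of_forall_pderiv_eq_zero p hzero
  have hp := (Fact.out : p.Prime)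
  have hg0 : g ≠ 0 := by
    rintro rfl
    simp [hp.ne_zero] at hf0
  have hg : ∀ x ∈ J, eval x g = 0 := fun x hx => by
    simpa [hp.ne_zero] using hf x hx
  have hle := hmin g hg0 hg
  obtain ⟨n, rfl⟩ : ∃ n, p = n + 2 := ⟨p - 2, by have := hp.two_le; omega⟩
  rw [pow_succ, totalDegree_mul_of_isDomain (pow_ne_zero _ hg0) hg0, pow_succ,
    totalDegree_mul_of_isDomain (pow_ne_zero _ hg0) hg0] at hle
  have hdeg : g.totalDegree = 0 := by omega
  obtain ⟨x, hx⟩ := hJ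
  rw [totalDegree_eq_zero_iff_eq_C] at hdeg
  have := hg x hx
  rw [hdeg, eval_C] at this
  rw [this, map_zero] at hdeg
  exact hg0 hdeg

theorem exists_ne_zero_totalDegree_le_of_card_lt {N : ℕ} {K : Type*} [Field K] (m : ℕ)
    (J : Finset (Fin N → K)) (hJ : J.card < m ^ N) :
    ∃ f : MvPolynomial (Fin N) K, f ≠ 0 ∧ (∀ x ∈ J, eval x f = 0) ∧
      f.totalDegree ≤ N * (m - 1) := by
  let e : (Fin N → Fin m) → (Fin N →₀ ℕ) := fun a => Finsupp.equivFunOnFinite.symm fun i => a i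
  have he : Function.Injective e := fun a b hab => by
    ext i
    exact DFunLike.congr_fun hab i
  let T := Fintype.linearCombination K fun a => monomial (e a) (1 : K)
  have hT : Function.Injective T := by
    have := (basisMonomials (Fin N) K).linearIndependent.comp e he
    rw [coe_basisMonomials] at this
    exact this.fintypeLinearCombination_injective
  let E : MvPolynomial (Fin N) K →ₗ[K] (J → K) := LinearMap.pi fun x => (aeval x.1).toLinearMap
  have hker : LinearMap.ker (E ∘ₗ T) ≠ ⊥ := by
    apply LinearMap.ker_ne_bot_of_finrank_lt
    simpa using hJ
  obtain ⟨c, hc, hc0⟩ := (Submodule.ne_bot_iff _).mp hker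
  refine ⟨T c, fun h => hc0 (hT (by simpa using h)), fun x hx => ?_, ?_⟩
  · have h : aeval x (T c) = 0 := congrFun (LinearMap.mem_ker.mp hc) ⟨x, hx⟩
    rwa [aeval_eq_eval] at h
  · rw [Fintype.linearCombination_apply]
    refine totalDegree_finsetSum_le fun a _ => (totalDegree_smul_le _ _).trans ?_
    refine (totalDegree_monomial_le _ _).trans ?_
    rw [Finsupp.sum_fintype _ _ (by simp)]
    calc ∑ i, e a i ≤ ∑ _i : Fin N, (m - 1) := Finset.sum_le_sum fun i _ => by
          have := (a i).2
          simp only [e, Finsupp.equivFunOnFinite_symm_apply_apply]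
          omega
      _ = _ := by simp

theorem eval_pderiv_bind₁ {σ τ R : Type*} [Fintype σ] [CommSemiring R]
    (l : σ → MvPolynomial τ R) (f : MvPolynomial σ R) (i : τ) (y : τ → R) :
    eval y (pderiv i (bind₁ l f)) =
      ∑ j, eval (fun j => eval y (l j)) (pderiv j f) * eval y (pderiv i (l j)) := by
  classical
  have hev : ∀ g, eval y (bind₁ l g) = eval (fun j => eval y (l j)) g := fun g => by
    rw [← coe_aeval_eq_eval, RingHom.coe_coe, aeval_bind₁]; rfl
  induction f using MvPolynomial.induction_on with
  | C a => simp
  | add f g hf hg => simp [hf, hg, add_mul, Finset.sum_add_distrib]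
  | mul_X f s hf =>
    simp only [map_mul, bind₁_X_right, pderiv_mul, map_add, hf, hev, pderiv_X, eval_X, add_mul,
      Finset.sum_add_distrib, Finset.sum_mul]
    congr 1
    · exact Finset.sum_congr rfl fun j _ => by ring
    · simp [Pi.single_apply, apply_ite]

theorem totalDegree_bind₁_le {σ τ R : Type*} [CommSemiring R]
    (l : σ → MvPolynomial τ R) (hl : ∀ j, (l j).totalDegree ≤ 1) (f : MvPolynomial σ R) :
    (bind₁ l f).totalDegree ≤ f.totalDegree := by
  conv_lhs => rw [f.as_sum, map_sum]
  refine totalDegree_finsetSum_le fun m hm => ?_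
  rw [bind₁_monomial]
  refine (totalDegree_mul _ _).trans ?_
  rw [totalDegree_C, zero_add]
  refine le_trans ?_ (le_totalDegree hm)
  refine (totalDegree_finsetProd _ _).trans (Finset.sum_le_sum fun j _ => ?_)
  refine (totalDegree_pow _ _).trans ?_
  simpa using Nat.mul_le_mul_left (m j) (hl j)

end MvPolynomial

open MvPolynomial in
theorem sum_eval_pderiv_mul_eq_zero {F K V : Type*} [Field F] [Fintype F] [Field K] [Algebra F K]
    [AddCommGroup V] [Module F V] {N : ℕ} (ψ : V →ₗ[F] (Fin N → K)) {f : MvPolynomial (Fin N) K}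
    (hdeg : 2 * f.totalDegree < Fintype.card F) (W : Submodule F V) [Module.Finite F W] (x : V)
    (hW : Fintype.card F ^ Module.finrank F W ≤ 2 * {w : W | eval (ψ (x + w)) f = 0}.ncard)
    {w : V} (hw : w ∈ W) : ∑ j, eval (ψ x) (pderiv j f) * ψ w j = 0 := by
  classical
  set k := Module.finrank F W
  let b : Module.Basis (Fin k) F W := Module.finBasis F W
  have : Finite W := Module.finite_of_finite F
  let l : Fin N → MvPolynomial (Fin k) K := fun j =>
    C (ψ x j) + ∑ i, C (ψ (b i) j) * X i
  have hl : ∀ j, (l j).totalDegree ≤ 1 := fun j => by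
    refine (totalDegree_add _ _).trans (max_le (by simp) (totalDegree_finsetSum_le fun i _ => ?_))
    exact (totalDegree_mul _ _).trans (by simp)
  have hzero : bind₁ l f = 0 := by
    by_contra hne
    have hSZ := schwartz_zippel_totalDegree hne (Finset.univ.image (algebraMap F K))
    rw [Finset.card_image_of_injective _ (algebraMap F K).injective, Finset.card_univ] at hSZ
    have hcard : {w : W | eval (ψ (x + w)) f = 0}.ncard ≤
        (Finset.filter (fun y => eval y (bind₁ l f) = 0)
          (Fintype.piFinset fun _ : Fin k => Finset.univ.image (algebraMap F K))).card := by
      rw [← Set.ncard_coe_finset]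
      refine Set.ncard_le_ncard_of_injOn (fun w i => algebraMap F K (b.equivFun w i)) ?_ ?_
        (Finset.finite_toSet _)
      · intro w hw
        have hev : (fun j => eval (fun i => algebraMap F K (b.equivFun w i)) (l j)) = ψ (x + w) := by
          have hw' : (w : V) = ∑ i, b.equivFun w i • (b i : V) := by
            have h := congrArg W.subtype (b.sum_equivFun w)
            rw [map_sum] at h
            exact h.symm
          funext j
          rw [hw', map_add, map_sum]
          simp [Algebra.smul_def, mul_comm]
        have hb : eval (fun i => algebraMap F K (b.equivFun w i)) (bind₁ l f) =
            eval (ψ (x + w)) f := by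
          rw [← hev, ← coe_aeval_eq_eval, RingHom.coe_coe, aeval_bind₁]
          rfl
        simp only [Finset.coe_filter, Fintype.mem_piFinset, Set.mem_ofPred_eq]
        exact ⟨fun i => Finset.mem_image_of_mem _ (Finset.mem_univ _), hb.trans hw⟩
      · intro w _ w' _ h
        apply b.equivFun.injective
        funext i
        exact (algebraMap F K).injective (congrFun h i)
    have hq : (0 : ℚ≥0) < Fintype.card F := by exact_mod_cast Fintype.card_pos
    rw [div_le_div_iff₀ (by positivity) hq] at hSZ
    norm_cast at hSZ
    have h1 := totalDegree_bind₁_le l hl f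
    have h2 : 0 < Fintype.card F ^ k := pow_pos Fintype.card_pos _
    have h3 := hW.trans (Nat.mul_le_mul_left 2 hcard)
    nlinarith
  have hbasis : ∀ i, ∑ j, eval (ψ x) (pderiv j f) * ψ (b i) j = 0 := fun i => by
    have h := eval_pderiv_bind₁ l f i 0
    rw [hzero] at h
    simpa [l, pderiv_X, Pi.single_apply, apply_ite] using h.symm
  let Λ : V →ₗ[F] K := ∑ j, (LinearMap.mulLeft F (eval (ψ x) (pderiv j f))) ∘ₗ
    LinearMap.proj j ∘ₗ ψ
  have hΛ : Λ ∘ₗ W.subtype = 0 := b.ext fun i => by simpa [Λ] using hbasis i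
  simpa [Λ] using LinearMap.congr_fun hΛ ⟨w, hw⟩

/-- The `F`-linear Moore map `v ↦ (φ v, φ v ^ q, …, φ v ^ q ^ (N - 1))`, where `q = |F|`. -/
noncomputable def mooreMap {F K V : Type*} [Field F] [Fintype F] [Field K] [Algebra F K]
    [AddCommGroup V] [Module F V] (φ : V →ₗ[F] K) (N : ℕ) : V →ₗ[F] (Fin N → K) :=
  LinearMap.pi fun j => (FiniteField.frobeniusAlgHom F K ^ (j : ℕ)).toLinearMap ∘ₗ φ

theorem mooreMap_apply {F K V : Type*} [Field F] [Fintype F] [Field K] [Algebra F K]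
    [AddCommGroup V] [Module F V] (φ : V →ₗ[F] K) (N : ℕ) (v : V) (j : Fin N) :
    mooreMap φ N v j = φ v ^ Fintype.card F ^ (j : ℕ) := by
  have h : ∀ (n : ℕ) (y : K), (FiniteField.frobeniusAlgHom F K ^ n) y =
      y ^ Fintype.card F ^ n := by
    intro n
    induction n with
    | zero => simp
    | succ n ih =>
      intro y
      rw [pow_succ', AlgHom.mul_apply, ih, FiniteField.frobeniusAlgHom_apply, ← pow_mul, pow_succ]
  exact h _ _

open Polynomial in
theorem card_le_of_sum_mul_mooreMap_eq_zero {F K V : Type*} [Field F] [Fintype F] [Field K]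
    [Algebra F K] [AddCommGroup V] [Module F V] {φ : V →ₗ[F] K} (hφ : Function.Injective φ) {d : ℕ}
    {c : Fin (d + 1) → K} (hc : c ≠ 0) (B : Finset V)
    (hB : ∀ v ∈ B, ∑ j, c j * mooreMap φ (d + 1) v j = 0) : B.card ≤ Fintype.card F ^ d := by
  classical
  have hq : 1 < Fintype.card F := Fintype.one_lt_card
  let P : K[X] := ∑ j, C (c j) * X ^ Fintype.card F ^ (j : ℕ)
  have hP : P ≠ 0 := by
    intro h
    apply hc
    funext i
    have hi := congrArg (fun Q : K[X] => Q.coeff (Fintype.card F ^ (i : ℕ))) h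
    simpa [P, coeff_X_pow, Nat.pow_right_inj hq, Fin.val_inj] using hi
  have hdeg : P.natDegree ≤ Fintype.card F ^ d := by
    refine natDegree_sum_le_of_forall_le _ _ fun j _ => (natDegree_C_mul_X_pow_le _ _).trans ?_
    exact Nat.pow_le_pow_right hq.le (Nat.lt_succ_iff.mp j.2)
  rw [← Finset.card_image_of_injective B hφ]
  refine (P.card_le_degree_of_subset_roots (fun y hy => ?_)).trans hdeg
  obtain ⟨v, hv, rfl⟩ := Finset.mem_image.mp (Finset.mem_val.mp hy)
  rw [mem_roots hP, IsRoot, eval_finsetSum]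
  simpa [mooreMap_apply] using hB v hv

open Finset Classical in
/-- Double counting with the potential `∑ x ∈ P, min (deg x) M`, where `deg x` is the number of
members of the family through `x`. -/
theorem card_mul_le_of_forall_exists_poor {α : Type*} (P : Finset α) (M t : ℕ)
    (L : Finset (Set α))
    (h : ∀ S ⊆ L, S.Nonempty →
      ∃ A ∈ S, t ≤ 2 * #{x ∈ P | x ∈ A ∧ #{A ∈ S | x ∈ A} ≤ M}) :
    #L * t ≤ 2 * (#P * M) := by
  suffices H : ∀ S ⊆ L, #S * t ≤ 2 * ∑ x ∈ P, min #{A ∈ S | x ∈ A} M by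
    refine (H L Subset.rfl).trans (Nat.mul_le_mul_left 2 ?_)
    rw [← smul_eq_mul]
    exact sum_le_card_nsmul _ _ _ fun x _ => min_le_right _ _
  intro S
  induction S using Finset.strongInduction with
  | H S ih =>
    intro hS
    rcases S.eq_empty_or_nonempty with rfl | hne
    · simp
    obtain ⟨A, hA, ht⟩ := h S hS hne
    have hA' := ih (S.erase A) (erase_ssubset hA) ((erase_subset _ _).trans hS)
    have hsum : ∑ x ∈ P, min #{B ∈ S.erase A | x ∈ B} M +
        #{x ∈ P | x ∈ A ∧ #{A ∈ S | x ∈ A} ≤ M} ≤ ∑ x ∈ P, min #{B ∈ S | x ∈ B} M := by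
      rw [card_filter, ← sum_add_distrib]
      refine sum_le_sum fun x _ => ?_
      have hmono : #{B ∈ S.erase A | x ∈ B} ≤ #{B ∈ S | x ∈ B} :=
        card_le_card (filter_subset_filter _ (erase_subset _ _))
      split_ifs with hx
      · have : #{B ∈ S.erase A | x ∈ B} + 1 = #{B ∈ S | x ∈ B} := by
          rw [filter_erase]
          exact card_erase_add_one (by simp [hA, hx.1])
        omega
      · omega
    have hcard : #S = #(S.erase A) + 1 := (card_erase_add_one hA).symm
    rw [hcard, add_mul]
    omega

open Finset Classical in
theorem card_submodule_mul_le {F V : Type*} [Field F] [Fintype F] [AddCommGroup V] [Module F V]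
    [Finite V] {k : ℕ} (S : Finset (Submodule F V)) (B : Finset V)
    (hS : ∀ W ∈ S, Module.finrank F W = k ∧ ∀ w ∈ W, w ∈ B) :
    #S * Fintype.card F ^ (k * k) ≤ 2 ^ k * #B ^ k := by
  have := Fintype.ofFinite V
  let I : Submodule F V → Finset (Fin k → V) := fun W =>
    {s | LinearIndependent F s ∧ Submodule.span F (Set.range s) = W}
  have hdisj : (S : Set (Submodule F V)).PairwiseDisjoint I := by
    intro W _ W' _ hne
    rw [Function.onFun, Finset.disjoint_left]
    intro s hs hs'
    simp only [I, mem_filter_univ] at hs hs'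
    exact hne (hs.2.symm.trans hs'.2)
  have hsub : S.biUnion I ⊆ Fintype.piFinset fun _ => B := by
    intro s hs
    obtain ⟨W, hW, hs⟩ := mem_biUnion.mp hs
    simp only [I, mem_filter_univ] at hs
    refine Fintype.mem_piFinset.mpr fun i => (hS W hW).2 _ ?_
    rw [← hs.2]
    exact Submodule.subset_span ⟨i, rfl⟩
  have hI : ∀ W ∈ S, Fintype.card F ^ (k * k) ≤ 2 ^ k * #(I W) := by
    intro W hW
    have hk := (hS W hW).1
    have hle : Nat.card {s : Fin k → W // LinearIndependent F s} ≤ #(I W) := by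
      rw [← Fintype.card_coe (I W), ← Nat.card_eq_fintype_card]
      refine Nat.card_le_card_of_injective (fun s => ⟨fun i => (s.1 i : V), ?_⟩) ?_
      · have hli : LinearIndependent F fun i => (s.1 i : V) :=
          s.2.map' W.subtype W.ker_subtype
        simp only [I, mem_filter_univ]
        refine ⟨hli, Submodule.eq_of_le_of_finrank_eq ?_ ?_⟩
        · rw [Submodule.span_le]
          rintro _ ⟨i, rfl⟩
          exact (s.1 i).2
        · rw [finrank_span_eq_card hli, hk, Fintype.card_fin]
      · intro s s' h
        ext i
        exact congrFun (congrArg Subtype.val h) i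
    rw [card_linearIndependent hk.ge, hk] at hle
    have hq : 2 ≤ Fintype.card F := Fintype.one_lt_card
    calc Fintype.card F ^ (k * k) = ∏ _i : Fin k, Fintype.card F ^ k := by simp [pow_mul]
      _ ≤ ∏ i : Fin k, 2 * (Fintype.card F ^ k - Fintype.card F ^ (i : ℕ)) := by
        refine prod_le_prod' fun i _ => ?_
        have h1 : Fintype.card F ^ (i + 1 : ℕ) ≤ Fintype.card F ^ k :=
          Nat.pow_le_pow_right (by omega) i.2
        rw [pow_succ] at h1
        have h2 : Fintype.card F ^ (i : ℕ) * 2 ≤ Fintype.card F ^ (i : ℕ) * Fintype.card F :=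
          Nat.mul_le_mul_left _ hq
        omega
      _ ≤ _ := by
        rw [prod_mul_distrib]
        simpa using hle
  calc #S * Fintype.card F ^ (k * k) ≤ ∑ W ∈ S, 2 ^ k * #(I W) := by
        rw [← smul_eq_mul]
        exact card_nsmul_le_sum _ _ _ hI
    _ = 2 ^ k * #(S.biUnion I) := by rw [card_biUnion hdisj, mul_sum]
    _ ≤ 2 ^ k * #B ^ k := by
      refine Nat.mul_le_mul_left _ ((card_le_card hsub).trans ?_)
      simp

theorem IsPlane.exists_eq_vadd {F V : Type*} [Field F] [AddCommGroup V] [Module F V] {k : ℕ}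
    {A : Set V} (hA : IsPlane F k A) {x : V} (hx : x ∈ A) :
    ∃ W : Submodule F V, Module.finrank F W = k ∧ A = x +ᵥ (W : Set V) := by
  obtain ⟨y, W, hW, rfl⟩ := hA
  refine ⟨W, hW, ?_⟩
  obtain ⟨w, hw, rfl⟩ := hx
  ext z
  simp only [Set.mem_vadd_set_iff_neg_vadd_mem, vadd_eq_add, SetLike.mem_coe]
  rw [← W.add_mem_iff_right hw (y := -(y + w) + z)]
  congr! 1
  abel

theorem IsPlane.ncard_eq {F V : Type*} [Field F] [Fintype F] [AddCommGroup V] [Module F V]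
    [Finite V] {k : ℕ} {A : Set V} (hA : IsPlane F k A) : A.ncard = Fintype.card F ^ k := by
  obtain ⟨y, W, rfl, rfl⟩ := hA
  rw [Set.ncard_vadd_set, ← Nat.card_coe_set_eq, ← Nat.card_eq_fintype_card]
  exact Module.natCard_eq_pow_finrank

open Finset Classical in
theorem card_pow_lt_card_bush {F V : Type*} [Field F] [Fintype F] [AddCommGroup V]
    [Module F V] [Fintype V] {d k : ℕ} (hkd : k ≤ d) (S : Finset (Set V))
    (hS : ∀ A ∈ S, IsPlane F k A) (x : V)
    (hx : 2 ^ k * Fintype.card F ^ (k * (d - k)) < #{A ∈ S | x ∈ A}) :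
    Fintype.card F ^ d < #{w : V | ∃ A ∈ S, x ∈ A ∧ x + w ∈ A} := by
  by_contra! hB
  let D : Finset (Submodule F V) := Set.toFinset
    {W : Submodule F V | Module.finrank F W = k ∧ x +ᵥ (W : Set V) ∈ S}
  have hsub : {A ∈ S | x ∈ A} ⊆ D.image fun W : Submodule F V => x +ᵥ (W : Set V) := by
    intro A hA
    rw [mem_filter] at hA
    obtain ⟨W, hW, rfl⟩ := (hS A hA.1).exists_eq_vadd hA.2
    exact mem_image.mpr ⟨W, by simp [D, hW, hA.1], rfl⟩
  have hD := card_submodule_mul_le (k := k) D {w : V | ∃ A ∈ S, x ∈ A ∧ x + w ∈ A} fun W hW => by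
    simp only [D, Set.mem_toFinset, Set.mem_ofPred_eq] at hW
    refine ⟨hW.1, fun w hw => ?_⟩
    rw [mem_filter_univ]
    exact ⟨_, hW.2, ⟨0, W.zero_mem, by simp⟩, ⟨w, hw, rfl⟩⟩
  have hq : 0 < Fintype.card F ^ (k * k) := pow_pos Fintype.card_pos _
  have hle : #D * Fintype.card F ^ (k * k) ≤
      2 ^ k * Fintype.card F ^ (k * (d - k)) * Fintype.card F ^ (k * k) := by
    refine hD.trans ?_
    rw [mul_assoc, ← pow_add, ← mul_add, Nat.sub_add_cancel hkd, mul_comm k d, pow_mul]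
    exact Nat.mul_le_mul_left _ (Nat.pow_le_pow_left hB k)
  exact hx.not_ge ((card_le_card hsub).trans
    (card_image_le.trans (Nat.le_of_mul_le_mul_right hle hq)))

open MvPolynomial in
theorem exists_minimal_totalDegree_of_card_lt {K : Type*} [Field K] {N q : ℕ} (hN : 0 < N)
    (hq : 0 < q) (J : Finset (Fin N → K)) (hJ : (2 * N) ^ N * J.card < q ^ N) :
    ∃ f : MvPolynomial (Fin N) K, f ≠ 0 ∧ (∀ x ∈ J, eval x f = 0) ∧ 2 * f.totalDegree < q ∧
      ∀ g : MvPolynomial (Fin N) K, g ≠ 0 → (∀ x ∈ J, eval x g = 0) →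
        f.totalDegree ≤ g.totalDegree := by
  obtain ⟨m, hm, hm'⟩ : ∃ m, q ≤ 2 * N * m ∧ 2 * N * (m - 1) < q := by
    refine ⟨(q - 1) / (2 * N) + 1, ?_, ?_⟩
    · have := Nat.lt_mul_div_succ (q - 1) (show 0 < 2 * N by omega)
      omega
    · have := Nat.mul_div_le (q - 1) (2 * N)
      simp only [Nat.add_sub_cancel]
      omega
  have hcard : J.card < m ^ N := by
    refine Nat.lt_of_mul_lt_mul_left (a := (2 * N) ^ N) (hJ.trans_le ?_)
    rw [← mul_pow]
    exact Nat.pow_le_pow_left hm N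
  obtain ⟨f₀, hf₀, hf₀J, hdeg₀⟩ := exists_ne_zero_totalDegree_le_of_card_lt m J hcard
  obtain ⟨f, ⟨hf, hfJ⟩, hmin⟩ := (measure (totalDegree (R := K) (σ := Fin N))).wf.has_min
    {f | f ≠ 0 ∧ ∀ x ∈ J, eval x f = 0} ⟨f₀, hf₀, hf₀J⟩
  have hmin' : ∀ g : MvPolynomial (Fin N) K, g ≠ 0 → (∀ x ∈ J, eval x g = 0) →
      f.totalDegree ≤ g.totalDegree := fun g hg hgJ => not_lt.mp (hmin g ⟨hg, hgJ⟩)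
  refine ⟨f, hf, hfJ, ?_, hmin'⟩
  have := (hmin' f₀ hf₀ hf₀J).trans hdeg₀
  rw [mul_assoc] at hm'
  omega

open Finset Classical MvPolynomial in
/-- A family of `k`-planes contained in a small set `P` contains a subfamily one of whose members
consists mostly of points of low multiplicity. -/
theorem exists_poor_plane {F K V : Type*} [Field F] [Fintype F] [AddCommGroup V] [Module F V]
    [Fintype V] [Field K] [Algebra F K] (p : ℕ) [Fact p.Prime] [CharP K p] [PerfectRing K p]
    {φ : V →ₗ[F] K} (hφ : Function.Injective φ) {d k : ℕ} (hkd : k ≤ d) (P : Finset V)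
    (hP : (2 * (d + 1)) ^ (d + 1) * #P < Fintype.card F ^ (d + 1)) (S : Finset (Set V))
    (hne : S.Nonempty) (hS : ∀ A ∈ S, IsPlane F k A) (hSP : ∀ A ∈ S, A ⊆ P) :
    ∃ A ∈ S, Fintype.card F ^ k ≤ 2 * #{x ∈ P | x ∈ A ∧
      #{A ∈ S | x ∈ A} ≤ 2 ^ k * Fintype.card F ^ (k * (d - k))} := by
  by_contra! hcon
  set M := 2 ^ k * Fintype.card F ^ (k * (d - k))
  have hq : 0 < Fintype.card F := Fintype.card_pos
  let R : Finset V := {x ∈ P | M < #{A ∈ S | x ∈ A}}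
  have hrich : ∀ A ∈ S, Fintype.card F ^ k < 2 * #{x ∈ R | x ∈ A} := by
    intro A hA
    have hAP : #{x ∈ P | x ∈ A} = Fintype.card F ^ k := by
      rw [← (hS A hA).ncard_eq, ← Set.ncard_coe_finset]
      congr 1
      ext x
      simpa using fun hx => hSP A hA hx
    have hsplit := card_filter_add_card_filter_not (s := {x ∈ P | x ∈ A})
      fun x => #{A ∈ S | x ∈ A} ≤ M
    have hpoor := hcon A hA
    rw [filter_filter, filter_filter, hAP] at hsplit
    have hR : {x ∈ R | x ∈ A} = {x ∈ P | x ∈ A ∧ ¬ #{A ∈ S | x ∈ A} ≤ M} := by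
      ext x
      simp only [R, mem_filter, not_le]
      tauto
    rw [hR]
    omega
  have hRne : R.Nonempty := by
    obtain ⟨A, hA⟩ := hne
    have hpos : 0 < #{x ∈ R | x ∈ A} := by
      have := hrich A hA
      omega
    exact (card_pos.mp hpos).mono (filter_subset _ _)
  let ψ := mooreMap φ (d + 1)
  have hJ : (2 * (d + 1)) ^ (d + 1) * #(R.image ψ) < Fintype.card F ^ (d + 1) :=
    (Nat.mul_le_mul_left _ (card_image_le.trans (card_le_card (filter_subset _ _)))).trans_lt hP
  obtain ⟨f, hf0, hfR, hdeg, hmin⟩ :=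
    exists_minimal_totalDegree_of_card_lt d.succ_pos hq (R.image ψ) hJ
  obtain ⟨_, hx, i, hi⟩ := exists_eval_pderiv_ne_zero p (J := (R.image ψ : Set (Fin (d + 1) → K)))
    (by simpa using hRne) hf0 hfR hmin
  obtain ⟨x, hxR, rfl⟩ := mem_image.mp (mem_coe.mp hx)
  have hbush := card_pow_lt_card_bush hkd S hS x (mem_filter.mp hxR).2
  refine hbush.not_ge (card_le_of_sum_mul_mooreMap_eq_zero hφ
    (c := fun j => eval (ψ x) (pderiv j f)) (fun h => hi (congrFun h i)) _ fun w hw => ?_)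
  obtain ⟨A, hA, hxA, hwA⟩ := (mem_filter_univ _).mp hw
  obtain ⟨W, hWk, rfl⟩ := (hS A hA).exists_eq_vadd hxA
  have hwW : w ∈ W := by
    obtain ⟨w', hw', h⟩ := hwA
    rwa [← add_left_cancel (show x + w' = x + w from h)]
  refine sum_eval_pderiv_mul_eq_zero ψ hdeg W x ?_ hwW
  rw [hWk]
  refine (hrich _ hA).le.trans (Nat.mul_le_mul_left 2 ?_)
  rw [← Set.ncard_coe_finset, ← Set.ncard_image_of_injective _
    ((add_right_injective x).comp Subtype.val_injective)]
  refine Set.ncard_le_ncard ?_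
  intro y hy
  obtain ⟨hyR, w', hw', rfl⟩ := mem_filter.mp (mem_coe.mp hy)
  exact ⟨⟨w', hw'⟩, hfR _ (mem_image_of_mem ψ hyR), rfl⟩

theorem exists_injective_linearMap_finite_field (F : Type) [Field F] [Fintype F] (p n : ℕ)
    [Fact p.Prime] [CharP F p] :
    ∃ φ : (Fin n → F) →ₗ[F] FiniteField.Extension F p (n + 1), Function.Injective φ := by
  apply rank_le_iff_exists_linearMap.mp
  rw [← Module.finrank_eq_rank, ← Module.finrank_eq_rank, FiniteField.finrank_extension]
  simp

open Finset in
theorem card_mul_le_of_isPlane {F : Type} [Field F] [Fintype F] {n d k : ℕ} (hkd : k ≤ d)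
    (P : Finset (Fin n → F)) (hP : (2 * (d + 1)) ^ (d + 1) * #P < Fintype.card F ^ (d + 1))
    (L : Finset (Set (Fin n → F))) (hL : ∀ A ∈ L, IsPlane F k A) (hLP : ∀ A ∈ L, A ⊆ P) :
    #L * Fintype.card F ^ k ≤ 2 * (#P * (2 ^ k * Fintype.card F ^ (k * (d - k)))) := by
  classical
  obtain ⟨p, hchar⟩ := CharP.exists F
  have : Fact p.Prime := ⟨CharP.char_is_prime F p⟩
  obtain ⟨φ, hφ⟩ := exists_injective_linearMap_finite_field F p n
  have : CharP (FiniteField.Extension F p (n + 1)) p :=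
    charP_of_injective_algebraMap (algebraMap F _).injective p
  refine card_mul_le_of_forall_exists_poor P _ _ L fun S hSL hne => ?_
  convert! exists_poor_plane p hφ hkd P hP S hne (fun A hA => hL A (hSL hA))
    fun A hA => hLP A (hSL hA)

/-- **Theorem 5 (unions of k-planes).** -/
theorem union_of_kplanes_lower_bound (d k : ℕ) (hk : 0 < k) (hkd : k ≤ d) :
    ∃ c : ℝ, 0 < c ∧
      ∀ (F : Type) [Field F] [Fintype F] (n : ℕ)
        (β : ℝ), 0 ≤ β → β ≤ 1 →
        ∀ L : Set (Set (Fin n → F)),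
          (∀ ℓ ∈ L, IsPlane F k ℓ) →
          (L.ncard : ℝ) ≥ (Fintype.card F : ℝ) ^ (((k : ℝ) + 1) * ((d : ℝ) - k) + β) →
          ((⋃₀ L).ncard : ℝ) ≥ c * (Fintype.card F : ℝ) ^ ((d : ℝ) + β) := by
  classical
  set C : ℝ := (2 * ((d : ℝ) + 1)) ^ (d + 1) with hC
  have hCpos : 0 < C := by positivity
  refine ⟨min (1 / C) (1 / 2 ^ (k + 1)), by positivity, ?_⟩
  intro F _ _ n β hβ0 hβ1 L hL hcard
  by_contra! hsmall
  set q : ℝ := (Fintype.card F : ℝ) with hq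
  have hq1 : 1 ≤ q := by
    rw [hq]
    exact_mod_cast Fintype.card_pos (α := F)
  have hq0 : 0 < q := by linarith
  have hpow : 0 < q ^ ((d : ℝ) + β) := Real.rpow_pos_of_pos hq0 _
  let P : Finset (Fin n → F) := (⋃₀ L).toFinset
  have hPcard : ((⋃₀ L).ncard : ℝ) = P.card := by rw [Set.ncard_eq_toFinset_card']
  have hLcard : (L.ncard : ℝ) = L.toFinset.card := by rw [Set.ncard_eq_toFinset_card']
  rw [hPcard] at hsmall
  rw [hLcard] at hcard
  have h1 : C * P.card < q ^ ((d : ℝ) + β) := by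
    have := hsmall.trans_le (mul_le_mul_of_nonneg_right (min_le_left _ _) hpow.le)
    rwa [one_div, ← div_eq_inv_mul, lt_div_iff₀' hCpos] at this
  have h2 : 2 ^ (k + 1) * (P.card : ℝ) < q ^ ((d : ℝ) + β) := by
    have := hsmall.trans_le (mul_le_mul_of_nonneg_right (min_le_right _ _) hpow.le)
    rwa [one_div, ← div_eq_inv_mul, lt_div_iff₀' (by positivity)] at this
  have hP : (2 * (d + 1)) ^ (d + 1) * P.card < Fintype.card F ^ (d + 1) := by
    have h3 : q ^ ((d : ℝ) + β) ≤ q ^ (d + 1) := by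
      rw [← Real.rpow_natCast]
      exact Real.rpow_le_rpow_of_exponent_le hq1 (by push_cast; linarith)
    have h4 := h1.trans_le h3
    rw [hC, hq] at h4
    exact_mod_cast h4
  have key := card_mul_le_of_isPlane hkd P hP L.toFinset (fun A hA => hL A (by simpa using hA))
    fun A hA => by simpa [P] using Set.subset_sUnion_of_mem (by simpa using hA)
  have key' : (L.toFinset.card : ℝ) * q ^ k ≤ 2 * (P.card * (2 ^ k * q ^ (k * (d - k)))) := by
    rw [hq]
    exact_mod_cast key
  have hexp : q ^ (((k : ℝ) + 1) * ((d : ℝ) - k) + β) * q ^ k =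
      q ^ ((d : ℝ) + β) * q ^ (k * (d - k)) := by
    rw [← Real.rpow_natCast, ← Real.rpow_natCast, ← Real.rpow_add hq0, ← Real.rpow_add hq0]
    push_cast [Nat.cast_sub hkd]
    ring_nf
  have hfinal : q ^ ((d : ℝ) + β) * q ^ (k * (d - k)) ≤
      2 ^ (k + 1) * (P.card : ℝ) * q ^ (k * (d - k)) := by
    rw [← hexp]
    calc _ ≤ (L.toFinset.card : ℝ) * q ^ k := by gcongr
      _ ≤ _ := key'
      _ = _ := by ring
  exact h2.not_ge (le_of_mul_le_mul_right hfinal (by positivity))
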